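/- Product integration error bound: under the stated setup (quadrature exactness degree n+k with 0 < k ≤ n) and assuming the Marcinkiewicz–Zygmund property with constant η ∈ (0,1), let h : [−1,1] → ℝ be measurable with ‖h‖₂ = (∫_{−1}^{1} h(x)² dx)^{1/2} < ∞. Then for every f ∈ C([−1,1]), the product integration rule based on the hyperinterpolant satisfies |∫_{−1}^{1} h(x)(L_n f)(x) dx − ∫_{−1}^{1} h(x) f(x) dx| ≤ (1/√(1−η) + 1) · ‖h‖₂ · 2^{1/2} · E_k(f), where E_k(f) = inf_{χ ∈ ℙ_k} sup_{x∈[−1,1]} |f(x) − χ(x)|. -/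

import Mathlib

open MeasureTheory

/-- The discrete inner product `⟨v,z⟩_m = ∑_j w_j v(x_j) z(x_j)` of an m-point
quadrature rule with points `x` and weights `w`. -/
noncomputable def discInner {m : ℕ} (w x : Fin m → ℝ) (v z : ℝ → ℝ) : ℝ :=
  ∑ j, w j * v (x j) * z (x j)

/-- The hyperinterpolant of degree `t`:  `L_t f = ∑_{ℓ=0}^{t} ⟨f, p_ℓ⟩_m p_ℓ`. -/
noncomputable def hyper {m : ℕ} (w x : Fin m → ℝ) (p : ℕ → Polynomial ℝ)
    (t : ℕ) (f : ℝ → ℝ) : Polynomial ℝ :=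
  ∑ ℓ ∈ Finset.range (t + 1),
    Polynomial.C (discInner w x f (fun y => (p ℓ).eval y)) * p ℓ

/-- The "tail" operator `(L_n − L_k) f = ∑_{ℓ=k+1}^{n} ⟨f, p_ℓ⟩_m p_ℓ`. -/
noncomputable def hyperDiff {m : ℕ} (w x : Fin m → ℝ) (p : ℕ → Polynomial ℝ)
    (k n : ℕ) (f : ℝ → ℝ) : Polynomial ℝ :=
  ∑ ℓ ∈ Finset.Ioc k n,
    Polynomial.C (discInner w x f (fun y => (p ℓ).eval y)) * p ℓ

/-- A family `p₀, …, p_n` of polynomials with `deg p_ℓ = ℓ` spans the polynomials of degree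
less than `t`, for each `t ≤ n + 1`. -/
theorem exists_eq_sum_of_degree_lt {n : ℕ} {p : ℕ → Polynomial ℝ}
    (hdeg : ∀ ℓ, ℓ ≤ n → (p ℓ).natDegree = ℓ) (hne : ∀ ℓ, ℓ ≤ n → p ℓ ≠ 0) :
    ∀ t, t ≤ n + 1 → ∀ q : Polynomial ℝ, q.degree < t →
      ∃ a : ℕ → ℝ, q = ∑ ℓ ∈ Finset.range t, Polynomial.C (a ℓ) * p ℓ := by
  intro t
  induction t with
  | zero =>
    intro _ q hq
    have hq0 : q = 0 := by
      rw [← Polynomial.degree_eq_bot]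
      simpa using hq
    exact ⟨0, by simp [hq0]⟩
  | succ t ih =>
    intro ht q hq
    have htn : t ≤ n := by omega
    have hlead : (p t).coeff t ≠ 0 := by
      have := Polynomial.leadingCoeff_ne_zero.mpr (hne t htn)
      rwa [Polynomial.leadingCoeff, hdeg t htn] at this
    set c := q.coeff t / (p t).coeff t with hc
    have hlt : (q - Polynomial.C c * p t).degree < t := by
      rw [Polynomial.degree_lt_iff_coeff_zero]
      intro i hi
      rcases hi.eq_or_lt with rfl | hi
      · simp [hc, hlead]
      · have h1 : q.coeff i = 0 :=
          Polynomial.coeff_eq_zero_of_degree_lt (hq.trans_le (by exact_mod_cast hi))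
        have h2 : (p t).coeff i = 0 :=
          Polynomial.coeff_eq_zero_of_natDegree_lt (by rw [hdeg t htn]; exact hi)
        simp [h1, h2]
    obtain ⟨a, ha⟩ := ih (by omega) _ hlt
    refine ⟨Function.update a t c, ?_⟩
    rw [Finset.sum_range_succ, Function.update_self]
    have hsum : ∑ ℓ ∈ Finset.range t, Polynomial.C (Function.update a t c ℓ) * p ℓ =
        ∑ ℓ ∈ Finset.range t, Polynomial.C (a ℓ) * p ℓ := by
      refine Finset.sum_congr rfl fun ℓ hℓ => ?_
      rw [Function.update_of_ne (Finset.mem_range.mp hℓ).ne]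
    rw [hsum, ← ha]
    ring

/-- The coefficients of a combination of orthonormal polynomials are its inner products. -/
theorem integral_sum_mul_orthonormal {n : ℕ} {p : ℕ → Polynomial ℝ}
    (horth : ∀ ℓ ℓ', ℓ ≤ n → ℓ' ≤ n →
      (∫ y in (-1 : ℝ)..1, (p ℓ).eval y * (p ℓ').eval y) = if ℓ = ℓ' then 1 else 0)
    (a : ℕ → ℝ) {i : ℕ} (hi : i ≤ n) :
    ∫ y in (-1 : ℝ)..1,
      (∑ ℓ ∈ Finset.range (n + 1), Polynomial.C (a ℓ) * p ℓ).eval y * (p i).eval y = a i := by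
  have hcont : ∀ q : Polynomial ℝ, Continuous fun y => q.eval y := fun q => q.continuous
  simp only [Polynomial.eval_finsetSum, Polynomial.eval_mul, Polynomial.eval_C, Finset.sum_mul,
    mul_assoc]
  rw [intervalIntegral.integral_finsetSum]
  · simp only [intervalIntegral.integral_const_mul]
    rw [Finset.sum_eq_single i]
    · simp [horth i i hi hi]
    · intro ℓ hℓ hne
      rw [horth ℓ i (by simpa [Nat.lt_succ_iff] using hℓ) hi, if_neg hne, mul_zero]
    · intro hmem
      exact absurd (Finset.mem_range.mpr (by omega)) hmem
  · intro ℓ _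
    exact (continuous_const.mul ((hcont _).mul (hcont _))).intervalIntegrable _ _

/-- Hyperinterpolation of degree `n` with exactness degree `n + k` reproduces the polynomials of
degree at most `k`. -/
theorem hyper_eval_eq_self {n k m : ℕ} (hkn : k ≤ n) {x w : Fin m → ℝ}
    (hex : ∀ g : Polynomial ℝ, g.natDegree ≤ n + k →
      ∑ j, w j * g.eval (x j) = ∫ y in (-1 : ℝ)..1, g.eval y)
    {p : ℕ → Polynomial ℝ} (hdeg : ∀ ℓ, ℓ ≤ n → (p ℓ).natDegree = ℓ)
    (horth : ∀ ℓ ℓ', ℓ ≤ n → ℓ' ≤ n →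
      (∫ y in (-1 : ℝ)..1, (p ℓ).eval y * (p ℓ').eval y) = if ℓ = ℓ' then 1 else 0)
    {q : Polynomial ℝ} (hq : q.natDegree ≤ k) :
    hyper w x p n (fun y => q.eval y) = q := by
  have hne : ∀ ℓ, ℓ ≤ n → p ℓ ≠ 0 := by
    intro ℓ hℓ h0
    simpa [h0] using horth ℓ ℓ hℓ hℓ
  have hqlt : q.degree < ((n + 1 : ℕ) : WithBot ℕ) :=
    lt_of_le_of_lt Polynomial.degree_le_natDegree (by exact_mod_cast (by omega))
  obtain ⟨a, ha⟩ := exists_eq_sum_of_degree_lt hdeg hne (n + 1) le_rfl q hqlt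
  conv_rhs => rw [ha]
  unfold hyper
  refine Finset.sum_congr rfl fun ℓ hℓ => ?_
  have hℓn : ℓ ≤ n := by simpa [Nat.lt_succ_iff] using hℓ
  congr 2
  have hdegmul : (q * p ℓ).natDegree ≤ n + k := by
    have := Polynomial.natDegree_mul_le (p := q) (q := p ℓ)
    have := hdeg ℓ hℓn
    omega
  have hquad := hex (q * p ℓ) hdegmul
  simp only [Polynomial.eval_mul] at hquad
  simp only [discInner, mul_assoc]
  rw [hquad]
  conv_lhs => rw [ha]
  exact integral_sum_mul_orthonormal horth a hℓn

/-- The hyperinterpolant is additive with respect to differences. -/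
theorem hyper_sub {m : ℕ} (w x : Fin m → ℝ) (p : ℕ → Polynomial ℝ) (t : ℕ) (f g : ℝ → ℝ) :
    hyper w x p t (fun y => f y - g y) = hyper w x p t f - hyper w x p t g := by
  simp only [hyper, discInner, mul_sub, sub_mul, Finset.sum_sub_distrib, map_sub]

theorem natDegree_hyper_le {n m : ℕ} {w x : Fin m → ℝ} {p : ℕ → Polynomial ℝ}
    (hdeg : ∀ ℓ, ℓ ≤ n → (p ℓ).natDegree = ℓ) (g : ℝ → ℝ) :
    (hyper w x p n g).natDegree ≤ n := by
  refine Polynomial.natDegree_sum_le_of_forall_le _ _ fun ℓ hℓ => ?_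
  have hℓn : ℓ ≤ n := by simpa [Nat.lt_succ_iff] using hℓ
  exact (Polynomial.natDegree_C_mul_le _ _).trans (by rw [hdeg ℓ hℓn]; exact hℓn)

/-- `‖L_n g‖₂² = ⟨g, L_n g⟩_m`. -/
theorem integral_hyper_sq {n m : ℕ} {w x : Fin m → ℝ} {p : ℕ → Polynomial ℝ}
    (horth : ∀ ℓ ℓ', ℓ ≤ n → ℓ' ≤ n →
      (∫ y in (-1 : ℝ)..1, (p ℓ).eval y * (p ℓ').eval y) = if ℓ = ℓ' then 1 else 0)
    (g : ℝ → ℝ) :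
    ∫ y in (-1 : ℝ)..1, ((hyper w x p n g).eval y) ^ 2 =
      discInner w x g (fun y => (hyper w x p n g).eval y) := by
  set b : ℕ → ℝ := fun ℓ => discInner w x g (fun y => (p ℓ).eval y) with hb
  set L := hyper w x p n g with hL
  have hLdef : L = ∑ ℓ ∈ Finset.range (n + 1), Polynomial.C (b ℓ) * p ℓ := rfl
  have heval : ∀ y, L.eval y = ∑ ℓ ∈ Finset.range (n + 1), b ℓ * (p ℓ).eval y := by
    intro y
    simp [hLdef, Polynomial.eval_finsetSum]
  have hleft : ∫ y in (-1 : ℝ)..1, (L.eval y) ^ 2 = ∑ ℓ ∈ Finset.range (n + 1), b ℓ * b ℓ := by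
    have hpt : ∀ y, (L.eval y) ^ 2 =
        ∑ ℓ ∈ Finset.range (n + 1), b ℓ * (L.eval y * (p ℓ).eval y) := by
      intro y
      rw [sq]
      nth_rewrite 2 [heval y]
      rw [Finset.mul_sum]
      exact Finset.sum_congr rfl fun ℓ _ => by ring
    simp only [hpt]
    rw [intervalIntegral.integral_finsetSum]
    · refine Finset.sum_congr rfl fun ℓ hℓ => ?_
      rw [intervalIntegral.integral_const_mul, hLdef,
        integral_sum_mul_orthonormal horth b (by simpa [Nat.lt_succ_iff] using hℓ)]
    · intro ℓ _
      exact (continuous_const.mul (L.continuous.mul (p ℓ).continuous)).intervalIntegrable _ _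
  rw [hleft]
  simp only [discInner, heval, Finset.mul_sum]
  rw [Finset.sum_comm]
  refine Finset.sum_congr rfl fun ℓ _ => ?_
  conv_lhs => rw [hb]
  simp only [discInner, Finset.mul_sum]
  conv_rhs => simp only [hb, discInner]
  refine Finset.sum_congr rfl fun j _ => by ring

/-- Under the Marcinkiewicz–Zygmund property, the hyperinterpolant of a function bounded by `ε`
at the quadrature points has `L²` norm at most `√2 ε / √(1 - η)`. -/
theorem sqrt_integral_hyper_sq_le {n m : ℕ} {x w : Fin m → ℝ} (hw : ∀ j, 0 < w j)
    (hsum : ∑ j, w j = 2) {p : ℕ → Polynomial ℝ}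
    (hdeg : ∀ ℓ, ℓ ≤ n → (p ℓ).natDegree = ℓ)
    (horth : ∀ ℓ ℓ', ℓ ≤ n → ℓ' ≤ n →
      (∫ y in (-1 : ℝ)..1, (p ℓ).eval y * (p ℓ').eval y) = if ℓ = ℓ' then 1 else 0)
    {η : ℝ} (hη : η ∈ Set.Ioo (0 : ℝ) 1)
    (hMZ : ∀ χ : Polynomial ℝ, χ.natDegree ≤ n →
      |(∑ j, w j * (χ.eval (x j)) ^ 2) - ∫ y in (-1 : ℝ)..1, (χ.eval y) ^ 2| ≤
        η * ∫ y in (-1 : ℝ)..1, (χ.eval y) ^ 2)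
    {g : ℝ → ℝ} {ε : ℝ} (hε : 0 ≤ ε) (hg : ∀ j, |g (x j)| ≤ ε) :
    √(∫ y in (-1 : ℝ)..1, ((hyper w x p n g).eval y) ^ 2) ≤ 1 / √(1 - η) * (√2 * ε) := by
  set L := hyper w x p n g with hL
  set N := ∫ y in (-1 : ℝ)..1, (L.eval y) ^ 2 with hN
  have hN0 : 0 ≤ N := intervalIntegral.integral_nonneg (by norm_num) fun y _ => sq_nonneg _
  have hη1 : 0 < 1 - η := by linarith [hη.2]
  have hMZL : ∑ j, w j * (L.eval (x j)) ^ 2 ≤ (1 + η) * N := by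
    have := (abs_le.mp (hMZ L (natDegree_hyper_le hdeg g))).2
    linarith
  have hgg : ∑ j, w j * (g (x j)) ^ 2 ≤ 2 * ε ^ 2 := by
    rw [← hsum, Finset.sum_mul]
    refine Finset.sum_le_sum fun j _ => mul_le_mul_of_nonneg_left ?_ (hw j).le
    exact sq_le_sq' (abs_le.mp (hg j)).1 (abs_le.mp (hg j)).2
  have hCS : N ^ 2 ≤ (∑ j, w j * (g (x j)) ^ 2) * ∑ j, w j * (L.eval (x j)) ^ 2 := by
    rw [hN, integral_hyper_sq horth g]
    refine Finset.sum_sq_le_sum_mul_sum_of_sq_le_mul _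
      (fun j _ => mul_nonneg (hw j).le (sq_nonneg _))
      (fun j _ => mul_nonneg (hw j).le (sq_nonneg _)) fun j _ => le_of_eq ?_
    ring
  have hN2 : N ^ 2 ≤ 2 * ε ^ 2 * ((1 + η) * N) :=
    hCS.trans (mul_le_mul hgg hMZL
      (Finset.sum_nonneg fun j _ => mul_nonneg (hw j).le (sq_nonneg _)) (by positivity))
  have hNle : N ≤ 2 * ε ^ 2 * (1 + η) := by
    rcases hN0.eq_or_lt with h0 | hpos
    · rw [← h0]
      have := hη.1
      positivity
    · exact le_of_mul_le_mul_right (by linarith [sq N]) hpos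
  refine Real.sqrt_le_iff.mpr ⟨by positivity, ?_⟩
  rw [mul_pow, div_pow, mul_pow, Real.sq_sqrt hη1.le, Real.sq_sqrt zero_le_two, one_pow,
    one_div, inv_mul_eq_div, le_div_iff₀ hη1]
  nlinarith [mul_le_mul_of_nonneg_right hNle hη1.le, mul_nonneg (sq_nonneg ε) (sq_nonneg η)]

/-- The Cauchy–Schwarz inequality for real functions in `L²(μ)`. -/
theorem abs_integral_mul_le_sqrt_mul_sqrt {α : Type*} [MeasurableSpace α] {μ : Measure α}
    {u v : α → ℝ} (hu : MemLp u 2 μ) (hv : MemLp v 2 μ) :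
    |∫ y, u y * v y ∂μ| ≤ √(∫ y, u y ^ 2 ∂μ) * √(∫ y, v y ^ 2 ∂μ) := by
  have hHolder := integral_mul_norm_le_Lp_mul_Lq (μ := μ) (f := u) (g := v)
    Real.HolderConjugate.two_two (by simpa using hu) (by simpa using hv)
  simp only [Real.rpow_two, Real.norm_eq_abs, sq_abs, ← Real.sqrt_eq_rpow, ← abs_mul] at hHolder
  exact (abs_integral_le_integral_abs).trans hHolder

/-- product integration error bound `|∫ h·L_n f − ∫ h·f| ≤ (1/√(1−η)+1) ‖h‖₂ √2 E_k(f)`. -/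
theorem product_integration_error
    (n k m : ℕ) (hn : 1 ≤ n) (hk0 : 0 < k) (hkn : k ≤ n)
    (x w : Fin m → ℝ)
    (hx : ∀ j, x j ∈ Set.Icc (-1 : ℝ) 1)
    (hw : ∀ j, 0 < w j)
    (hex : ∀ g : Polynomial ℝ, g.natDegree ≤ n + k →
      ∑ j, w j * g.eval (x j) = ∫ y in (-1 : ℝ)..1, g.eval y)
    (p : ℕ → Polynomial ℝ)
    (hdeg : ∀ ℓ, ℓ ≤ n → (p ℓ).natDegree = ℓ)
    (horth : ∀ ℓ ℓ', ℓ ≤ n → ℓ' ≤ n →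
      (∫ y in (-1 : ℝ)..1, (p ℓ).eval y * (p ℓ').eval y) = if ℓ = ℓ' then 1 else 0)
    (η : ℝ) (hη : η ∈ Set.Ioo (0 : ℝ) 1)
    (hMZ : ∀ χ : Polynomial ℝ, χ.natDegree ≤ n →
      |(∑ j, w j * (χ.eval (x j)) ^ 2) - ∫ y in (-1 : ℝ)..1, (χ.eval y) ^ 2| ≤
        η * ∫ y in (-1 : ℝ)..1, (χ.eval y) ^ 2)
    (f : ℝ → ℝ) (hf : ContinuousOn f (Set.Icc (-1 : ℝ) 1))
    (h : ℝ → ℝ) (hh : Measurable h)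
    (hh2 : IntervalIntegrable (fun y => (h y) ^ 2) MeasureTheory.volume (-1 : ℝ) 1) :
    |(∫ y in (-1 : ℝ)..1, h y * (hyper w x p n f).eval y) - ∫ y in (-1 : ℝ)..1, h y * f y| ≤
      (1 / Real.sqrt (1 - η) + 1) * Real.sqrt (∫ y in (-1 : ℝ)..1, (h y) ^ 2) *
        (Real.sqrt 2 *
          ⨅ χ : {q : Polynomial ℝ // q.natDegree ≤ k},
            ⨆ t : Set.Icc (-1 : ℝ) 1, |f t - (χ : Polynomial ℝ).eval (t : ℝ)|) := by
  have hcoef : 0 ≤ (1 / √(1 - η) + 1) * √(∫ y in (-1 : ℝ)..1, (h y) ^ 2) * √2 := by positivity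
  have hsum : ∑ j, w j = 2 := by
    have := hex 1 (by simp)
    norm_num at this
    exact this
  have : Nonempty {q : Polynomial ℝ // q.natDegree ≤ k} := ⟨⟨0, by simp⟩⟩
  rw [← mul_assoc, Real.mul_iInf_of_nonneg hcoef]
  refine le_ciInf fun χ => ?_
  obtain ⟨χ, hχ⟩ := χ
  simp only
  set g : ℝ → ℝ := fun y => f y - χ.eval y with hgdef
  set ε := ⨆ t : Set.Icc (-1 : ℝ) 1, |f t - χ.eval (t : ℝ)| with hεdef
  have hgc : ContinuousOn g (Set.Icc (-1) 1) := hf.sub χ.continuous.continuousOn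
  have hgε : ∀ t ∈ Set.Icc (-1 : ℝ) 1, |g t| ≤ ε := by
    have hbdd : BddAbove (Set.range fun t : Set.Icc (-1 : ℝ) 1 => |f t - χ.eval (t : ℝ)|) :=
      isCompact_range (hgc.domRestrict.abs) |>.bddAbove
    exact fun t ht => le_ciSup hbdd ⟨t, ht⟩
  have hε : 0 ≤ ε := Real.iSup_nonneg fun t => abs_nonneg _
  set μ := volume.restrict (Set.Ioc (-1 : ℝ) 1) with hμ
  have hmemCont : ∀ u : ℝ → ℝ, ContinuousOn u (Set.Icc (-1) 1) → MemLp u 2 μ := fun u hu =>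
    (memLp_two_iff_integrable_sq
      ((hu.mono Set.Ioc_subset_Icc_self).aestronglyMeasurable measurableSet_Ioc)).mpr
      ((hu.pow 2).integrableOn_Icc.mono_set Set.Ioc_subset_Icc_self)
  have hmemh : MemLp h 2 μ :=
    (memLp_two_iff_integrable_sq hh.aestronglyMeasurable).mpr
      ((intervalIntegrable_iff_integrableOn_Ioc_of_le (by norm_num)).mp hh2)
  set L := hyper w x p n g with hLdef
  have hhyper : hyper w x p n f = L + χ := by
    rw [hLdef, hgdef, hyper_sub, hyper_eval_eq_self hkn hex hdeg horth hχ]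
    ring
  have hmemL : MemLp (fun y => L.eval y) 2 μ := hmemCont _ L.continuous.continuousOn
  have hmemg : MemLp g 2 μ := hmemCont g hgc
  have hLbound := sqrt_integral_hyper_sq_le hw hsum hdeg horth hη hMZ hε fun j => hgε _ (hx j)
  rw [← hLdef] at hLbound
  have hgbound : √(∫ y in (-1 : ℝ)..1, g y ^ 2) ≤ √2 * ε := by
    have hle : ∫ y in (-1 : ℝ)..1, g y ^ 2 ≤ ∫ _y in (-1 : ℝ)..1, ε ^ 2 := by
      refine intervalIntegral.integral_mono_on (by norm_num) ?_ (by simp) fun y hy =>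
        sq_le_sq' (abs_le.mp (hgε y hy)).1 (abs_le.mp (hgε y hy)).2
      exact (hgc.pow 2).intervalIntegrable_of_Icc (by norm_num)
    refine Real.sqrt_le_iff.mpr ⟨by positivity, hle.trans_eq ?_⟩
    rw [mul_pow, Real.sq_sqrt zero_le_two, intervalIntegral.integral_const, smul_eq_mul]
    norm_num
  have hsplit : (∫ y in (-1 : ℝ)..1, h y * (hyper w x p n f).eval y) -
      ∫ y in (-1 : ℝ)..1, h y * f y = ∫ y, h y * L.eval y ∂μ - ∫ y, h y * g y ∂μ := by
    have hint : ∀ u : ℝ → ℝ, ContinuousOn u (Set.Icc (-1) 1) →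
        Integrable (fun y => h y * u y) μ := fun u hu => hmemh.integrable_mul (hmemCont u hu)
    rw [intervalIntegral.integral_of_le (by norm_num),
      intervalIntegral.integral_of_le (by norm_num),
      ← integral_sub (hint _ (Polynomial.continuous _).continuousOn) (hint f hf),
      ← integral_sub (hint _ L.continuous.continuousOn) (hint g hgc)]
    refine integral_congr_ae (Filter.Eventually.of_forall fun y => ?_)
    simp only [hhyper, Polynomial.eval_add, hgdef]
    ring
  have hCSL := abs_integral_mul_le_sqrt_mul_sqrt hmemh hmemL
  have hCSg := abs_integral_mul_le_sqrt_mul_sqrt hmemh hmemg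
  rw [intervalIntegral.integral_of_le (by norm_num)] at hLbound hgbound
  rw [hsplit, intervalIntegral.integral_of_le (by norm_num)]
  set H := √(∫ y in Set.Ioc (-1 : ℝ) 1, h y ^ 2) with hH
  calc |∫ y, h y * L.eval y ∂μ - ∫ y, h y * g y ∂μ|
      ≤ |∫ y, h y * L.eval y ∂μ| + |∫ y, h y * g y ∂μ| := abs_sub _ _
    _ ≤ H * (1 / √(1 - η) * (√2 * ε)) + H * (√2 * ε) :=
      add_le_add (hCSL.trans (mul_le_mul_of_nonneg_left hLbound (Real.sqrt_nonneg _)))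
        (hCSg.trans (mul_le_mul_of_nonneg_left hgbound (Real.sqrt_nonneg _)))
    _ = (1 / √(1 - η) + 1) * H * √2 * ε := by ring
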